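/- Let Γ be a G-set with exactly two valleys, the y-valley (i_y,j_y) and the z-valley (i_z,k_z), such that Γ = span((i,j_y,0),(i,0,k_z),(i_y,j,0),(i_z,0,k)) with i = i(Γ), j = j(Γ), k = k(Γ). Then: if k_z ≥ 1, TR(Γ) = span((i,j_y,0),(i,0,k_z−1),(i_y,j+1,0),(i_z,0,k)); if j_y ≥ 1, TL(Γ) = span((i,j_y−1,0),(i,0,k_z),(i_y,j,0),(i_z,0,k+1)); TUR(Γ) = span((i,j_y+1,0),(i,0,k_z),(i_y,j,0),(i_z,0,k−1)); and TUL(Γ) = span((i,j_y,0),(i,0,k_z+1),(i_y,j−1,0),(i_z,0,k)). -/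

import Mathlib

open scoped BigOperators Classical

namespace GH

/-- Exponent vectors of monomials `x^m y^n z^p`. -/
abbrev N3 : Type := ℕ × ℕ × ℕ

/-- The lattice `ℤ³`. -/
abbrev Z3 : Type := ℤ × ℤ × ℤ

/-- Inclusion `ℕ³ → ℤ³`. -/
def toZ (v : N3) : Z3 := ((v.1 : ℤ), (v.2.1 : ℤ), (v.2.2 : ℤ))

/-- The weight map `wt(m,n,p) = m + a·n + (r−a)·p (mod r)` on `ℤ³`. -/
def wtZ (r a : ℕ) (v : Z3) : ZMod r :=
  (v.1 : ZMod r) + (a : ZMod r) * (v.2.1 : ZMod r) + ((r - a : ℕ) : ZMod r) * (v.2.2 : ZMod r)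

/-- The weight map on `ℕ³`. -/
def wtN (r a : ℕ) (v : N3) : ZMod r := wtZ r a (toZ v)

/-- A `G`-set: contains the origin, closed under taking summands, and the weight map
restricted to it is a bijection onto `ℤ/rℤ`. -/
structure IsGSet (r a : ℕ) (Γ : Set N3) : Prop where
  zero_mem : (0, 0, 0) ∈ Γ
  dclosed : ∀ u v : N3, u + v ∈ Γ → u ∈ Γ ∧ v ∈ Γ
  bij : Set.BijOn (wtN r a) Γ Set.univ

/-- `wt_Γ(v)`: the (unique, for a `G`-set) element of `Γ` of the same weight as `v`. -/
noncomputable def wtG (r a : ℕ) (Γ : Set N3) (v : N3) : N3 :=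
  if h : ∃ w, w ∈ Γ ∧ wtN r a w = wtN r a v then h.choose else (0, 0, 0)

/-- `(m,n)` is a y-valley of `Γ`. -/
def IsYValley (Γ : Set N3) (m n : ℕ) : Prop :=
  (m, n, 0) ∈ Γ ∧ (m + 1, n, 0) ∈ Γ ∧ (m, n + 1, 0) ∈ Γ ∧ (m + 1, n + 1, 0) ∉ Γ

/-- `(m,n)` is a z-valley of `Γ`. -/
def IsZValley (Γ : Set N3) (m n : ℕ) : Prop :=
  (m, 0, n) ∈ Γ ∧ (m + 1, 0, n) ∈ Γ ∧ (m, 0, n + 1) ∈ Γ ∧ (m + 1, 0, n + 1) ∉ Γ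

/-- A primitive `G`-set: it has a y-valley `(i_y, 0)` and a z-valley `(i_z, 0)`. -/
def IsPrimG (Γ : Set N3) : Prop := (∃ p : ℕ, IsYValley Γ p 0) ∧ (∃ p : ℕ, IsZValley Γ p 0)

/-- `s_Γ(v) = v − wt_Γ(v) ∈ ℤ³`. -/
noncomputable def sG (r a : ℕ) (Γ : Set N3) (v : N3) : Z3 := toZ v - toZ (wtG r a Γ v)

/-- The submonoid `S(Γ)` of `ℤ³` generated by all `s_Γ(v)`. -/
noncomputable def SMon (r a : ℕ) (Γ : Set N3) : AddSubmonoid Z3 :=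
  AddSubmonoid.closure (Set.range (sG r a Γ))

/-- The lattice `M = { u ∈ ℤ³ : wt(u) = 0 }` of `G`-invariant monomials. -/
def latM (r a : ℕ) : Set Z3 := { u | wtZ r a u = 0 }

/-- The standard pairing of `ℝ³` with `ℤ³`. -/
def dotR (α : ℝ × ℝ × ℝ) (u : Z3) : ℝ :=
  α.1 * (u.1 : ℝ) + α.2.1 * (u.2.1 : ℝ) + α.2.2 * (u.2.2 : ℝ)

/-- The cone `σ(Γ) = { α ∈ ℝ³ : ⟨α, s_Γ(v)⟩ ≥ 0 for all v ∈ ℕ³ }`. -/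
noncomputable def sigmaCone (r a : ℕ) (Γ : Set N3) : Set (ℝ × ℝ × ℝ) :=
  { α | ∀ v : N3, 0 ≤ dotR α (sG r a Γ v) }

/-- `span(u₁,…,u_t)`: all `v ∈ ℕ³` dominated componentwise by some `u_s`. -/
def spanSet (s : Set N3) : Set N3 := { v | ∃ u ∈ s, v ≤ u }

/-- `i(Γ)`: the largest `m` with `(m,0,0) ∈ Γ`. -/
noncomputable def iOf (Γ : Set N3) : ℕ := sSup { m : ℕ | (m, 0, 0) ∈ Γ }

/-- `j(Γ)`: the largest `n` with `(0,n,0) ∈ Γ`. -/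
noncomputable def jOf (Γ : Set N3) : ℕ := sSup { n : ℕ | (0, n, 0) ∈ Γ }

/-- `k(Γ)`: the largest `p` with `(0,0,p) ∈ Γ`. -/
noncomputable def kOf (Γ : Set N3) : ℕ := sSup { p : ℕ | (0, 0, p) ∈ Γ }

/-- `c(w) = max { c : w − c·v ∈ ℕ³ }` (componentwise). -/
noncomputable def cmax (v w : N3) : ℕ := sSup { c : ℕ | c • v ≤ w }

/-- The `G`-igsaw transformation of `Γ` in the direction of `u`:
`T_u(Γ) = { w + c(w)·(u − v) : w ∈ Γ }` where `v = wt_Γ(u)`. -/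
noncomputable def jig (r a : ℕ) (Γ : Set N3) (u : N3) : Set N3 :=
  { w' | ∃ w ∈ Γ,
      toZ w' = toZ w + (cmax (wtG r a Γ u) w) • (toZ u - toZ (wtG r a Γ u)) }

/-- The upper transformation `TU(Γ)`. -/
noncomputable def TU (r a : ℕ) (Γ : Set N3) : Set N3 := jig r a Γ (iOf Γ + 1, 0, 0)

/-- The right transformation `TR(Γ)`. -/
noncomputable def TR (r a : ℕ) (Γ : Set N3) : Set N3 := jig r a Γ (0, jOf Γ + 1, 0)

/-- The left transformation `TL(Γ)`. -/
noncomputable def TL (r a : ℕ) (Γ : Set N3) : Set N3 := jig r a Γ (0, 0, kOf Γ + 1)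

/-- The y-valley of `Γ` (chosen by choice; unique for a `G`-set having one). -/
noncomputable def yValley (Γ : Set N3) : ℕ × ℕ :=
  if h : ∃ p : ℕ × ℕ, IsYValley Γ p.1 p.2 then h.choose else (0, 0)

/-- The z-valley of `Γ` (chosen by choice; unique for a `G`-set having one). -/
noncomputable def zValley (Γ : Set N3) : ℕ × ℕ :=
  if h : ∃ p : ℕ × ℕ, IsZValley Γ p.1 p.2 then h.choose else (0, 0)

/-- The upper right transformation `TUR(Γ)`, in the direction `(i_y+1, j_y+1, 0)`. -/
noncomputable def TUR (r a : ℕ) (Γ : Set N3) : Set N3 :=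
  jig r a Γ ((yValley Γ).1 + 1, (yValley Γ).2 + 1, 0)

/-- The upper left transformation `TUL(Γ)`, in the direction `(i_z+1, 0, k_z+1)`. -/
noncomputable def TUL (r a : ℕ) (Γ : Set N3) : Set N3 :=
  jig r a Γ ((zValley Γ).1 + 1, 0, (zValley Γ).2 + 1)

/-- The bound `min{j, k, j − j_y, k − k_z}` for the triangle of transformations. -/
noncomputable def minBound (Γ : Set N3) : ℕ :=
  min (min (jOf Γ) (kOf Γ)) (min (jOf Γ - (yValley Γ).2) (kOf Γ - (zValley Γ).2))

/-- The triangle of transformations `Θ(Γ)`. -/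
noncomputable def Theta (r a : ℕ) (Γ : Set N3) : Set (Set N3) :=
  { Γ' | ∃ p q : ℕ, p + q ≤ minBound Γ ∧ Γ' = (TUR r a)^[p] ((TUL r a)^[q] Γ) }

/-- The recursion step producing `Γ_{n+1}` from `Γ_n`. -/
noncomputable def nextGamma (r a : ℕ) (Γ : Set N3) : Set N3 :=
  if jOf Γ < kOf Γ then TU r a ((TUR r a)^[jOf Γ] Γ)
  else TU r a ((TUL r a)^[kOf Γ] Γ)

/-- The sequence of primitive `G`-sets; `GammaSeq r a b (n-1)` is `Γ_n`,
starting from `Γ₁ = span((1,0,0),(0,b−1,0),(0,0,r−b−1))`. -/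
noncomputable def GammaSeq (r a b : ℕ) : ℕ → Set N3
  | 0 => spanSet {(1, 0, 0), (0, b - 1, 0), (0, 0, r - b - 1)}
  | n + 1 => nextGamma r a (GammaSeq r a b n)


/-- The region `{(m, t)}` obtained from the span of `(i,jy,0), (i,0,kz), (iy,j,0), (iz,0,k)` by
recording `y^n z^p` as `t = n - p`. -/
def Region (i iy iz j jy k kz m t : ℤ) : Prop :=
  0 ≤ m ∧ m ≤ i ∧ -k ≤ t ∧ t ≤ j ∧ (iy < m → t ≤ jy) ∧ (iz < m → -kz ≤ t)

lemma region_upper_relation (L : AddSubgroup (ℤ × ℤ)) {i iy iz j jy k kz : ℤ}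
    (hiy : 0 ≤ iy) (hiyi : iy < i) (hjy : 0 ≤ jy) (hjyj : jy < j)
    (hiz : 0 ≤ iz) (hkz : 0 ≤ kz) (hkzk : kz < k)
    (inj : ∀ m t m' t', Region i iy iz j jy k kz m t → Region i iy iz j jy k kz m' t' →
      (m - m', t - t') ∈ L → m = m' ∧ t = t')
    (surj : ∀ m t, ∃ m' t', Region i iy iz j jy k kz m' t' ∧ (m - m', t - t') ∈ L) :
    (iy + 1, jy + k + 1) ∈ L := by
  obtain ⟨m, t, hr, hL⟩ := surj (iy + 1) (jy + 1)
  unfold Region at *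
  have hm : m = 0 := by
    by_contra hm
    have := inj iy (jy + 1) (m - 1) t (by omega) (by omega) (by convert hL using 2; ring)
    omega
  have ht : t ≤ -k := by
    by_contra ht
    have := inj (iy + 1) jy m (t - 1) (by omega) (by omega) (by convert hL using 2; ring)
    omega
  have ht' : t = -k := by omega
  subst hm ht'
  convert hL using 2 <;> ring

lemma region_neg {i iy iz j jy k kz m t : ℤ} :
    Region i iz iy k kz j jy m (-t) ↔ Region i iy iz j jy k kz m t := by
  unfold Region
  omega

/-- Reflection `(m, t) ↦ (m, -t)` of a subgroup of `ℤ²`. -/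
def reflect (L : AddSubgroup (ℤ × ℤ)) : AddSubgroup (ℤ × ℤ) :=
  L.comap ((AddMonoidHom.id ℤ).prodMap (-AddMonoidHom.id ℤ))

lemma mem_reflect {L : AddSubgroup (ℤ × ℤ)} {m t : ℤ} : (m, t) ∈ reflect L ↔ (m, -t) ∈ L :=
  Iff.rfl

lemma region_width_le (L : AddSubgroup (ℤ × ℤ)) {i iy iz j jy k kz : ℤ}
    (hiy : 0 ≤ iy) (hjy : 0 ≤ jy) (hjyj : jy < j)
    (hiz : 0 ≤ iz) (hkz : 0 ≤ kz) (hkzk : kz < k)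
    (inj : ∀ m t m' t', Region i iy iz j jy k kz m t → Region i iy iz j jy k kz m' t' →
      (m - m', t - t') ∈ L → m = m' ∧ t = t')
    (h1 : (iy + 1, jy + k + 1) ∈ L) (h2 : (iz + 1, -(kz + j + 1)) ∈ L) :
    i ≤ iy + iz + 1 := by
  by_contra h
  unfold Region at *
  have := inj (iy + iz + 2) 0 0 ((j - jy) - (k - kz)) (by omega) (by omega)
    (by convert L.add_mem h1 h2 using 1; ext <;> simp <;> ring)
  omega

/-- If the region is narrower than `iy + iz + 2` columns, the representative in column `0` of the
first point to the right of the region lies high up. -/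
lemma region_high (L : AddSubgroup (ℤ × ℤ)) {i iy iz j jy k kz t : ℤ}
    (hiy : 0 ≤ iy) (hiyi : iy < i) (hjy : 0 ≤ jy) (hjyj : jy < j) (hk : 0 < k) (hkz : 0 ≤ kz)
    (inj : ∀ m t m' t', Region i iy iz j jy k kz m t → Region i iy iz j jy k kz m' t' →
      (m - m', t - t') ∈ L → m = m' ∧ t = t')
    (h1 : (iy + 1, jy + k + 1) ∈ L) (hlt : i < iy + iz + 1)
    (hr : Region i iy iz j jy k kz 0 t) (hL : (i + 1 - 0, 0 - t) ∈ L) : j - jy ≤ t := by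
  by_contra h
  unfold Region at *
  have hd := L.sub_mem hL h1
  by_cases ht : t + jy + k + 1 ≤ j
  · have := inj (i - iy) 0 0 (t + jy + k + 1) (by omega) (by omega)
      (by convert hd using 1; (ext <;> simp); ring)
    omega
  · have := inj (i - iy) (j - (t + jy + k + 1)) 0 j (by omega) (by omega)
      (by convert hd using 1; (ext <;> simp); ring)
    omega

lemma region_relations (L : AddSubgroup (ℤ × ℤ)) {i iy iz j jy k kz : ℤ}
    (hiy : 0 ≤ iy) (hiyi : iy < i) (hjy : 0 ≤ jy) (hjyj : jy < j)
    (hiz : 0 ≤ iz) (hizi : iz < i) (hkz : 0 ≤ kz) (hkzk : kz < k)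
    (inj : ∀ m t m' t', Region i iy iz j jy k kz m t → Region i iy iz j jy k kz m' t' →
      (m - m', t - t') ∈ L → m = m' ∧ t = t')
    (surj : ∀ m t, ∃ m' t', Region i iy iz j jy k kz m' t' ∧ (m - m', t - t') ∈ L) :
    (iy + 1, jy + k + 1) ∈ L ∧ (iz + 1, -(kz + j + 1)) ∈ L ∧ i = iy + iz + 1 := by
  have inj' : ∀ m t m' t', Region i iz iy k kz j jy m t → Region i iz iy k kz j jy m' t' →
      (m - m', t - t') ∈ reflect L → m = m' ∧ t = t' := by
    intro m t m' t' h h' hL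
    have := inj m (-t) m' (-t') (region_neg.2 h) (region_neg.2 h')
      (by convert mem_reflect.1 hL using 2; ring)
    omega
  have surj' : ∀ m t, ∃ m' t', Region i iz iy k kz j jy m' t' ∧ (m - m', t - t') ∈ reflect L := by
    intro m t
    obtain ⟨m', t', h, hL⟩ := surj m (-t)
    exact ⟨m', -t', region_neg.2 h, mem_reflect.2 (by convert hL using 2; ring)⟩
  have h1 := region_upper_relation L hiy hiyi hjy hjyj hiz hkz hkzk inj surj
  have h2 := region_upper_relation (reflect L) hiz hizi hkz hkzk hiy hjy hjyj inj' surj'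
  have hle := region_width_le L hiy hjy hjyj hiz hkz hkzk inj h1 (mem_reflect.1 h2)
  refine ⟨h1, mem_reflect.1 h2, ?_⟩
  by_contra hne
  obtain ⟨m, t, hr, hL⟩ := surj (i + 1) 0
  have hm : m = 0 := by
    by_contra hm
    have := inj i 0 (m - 1) t (by unfold Region; omega) (by unfold Region at *; omega)
      (by convert hL using 2; ring)
    unfold Region at hr
    omega
  subst hm
  have := region_high L hiy hiyi hjy hjyj (by omega) hkz inj h1 (by omega) hr hL
  have := region_high (reflect L) hiz hizi hkz hkzk (by omega) hjy inj' h2 (by omega) (region_neg.2 hr)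
    (mem_reflect.2 (by convert hL using 2; ring))
  omega

/-- The lattice of `(m, t) ∈ ℤ²` with `m + a t ≡ 0` modulo `r`. -/
def weightLattice (r a : ℕ) : AddSubgroup (ℤ × ℤ) where
  carrier := {q | (q.1 : ZMod r) + a * (q.2 : ZMod r) = 0}
  zero_mem' := by simp
  add_mem' {x y} hx hy := by
    simp only [Set.mem_ofPred_eq, Prod.fst_add, Prod.snd_add, Int.cast_add] at *
    linear_combination hx + hy
  neg_mem' {x} hx := by
    simp only [Set.mem_ofPred_eq, Prod.fst_neg, Prod.snd_neg, Int.cast_neg] at *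
    linear_combination -hx

lemma wtN_eq_iff {r a : ℕ} (har : a ≤ r) (v w : N3) :
    wtN r a v = wtN r a w ↔
      ((v.1 : ℤ) - w.1, ((v.2.1 : ℤ) - v.2.2) - ((w.2.1 : ℤ) - w.2.2)) ∈ weightLattice r a := by
  have hc : ((r - a : ℕ) : ZMod r) = -a := by
    rw [Nat.cast_sub har]; simp
  change _ ↔ (_ : ZMod r) + a * _ = 0
  simp only [wtN, wtZ, toZ, hc]
  push_cast
  constructor <;> intro h <;> linear_combination h

lemma wtG_eq {r a : ℕ} {Γ : Set N3} (hΓ : IsGSet r a Γ) {u v : N3} (hv : v ∈ Γ)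
    (h : wtN r a v = wtN r a u) : wtG r a Γ u = v := by
  have hex : ∃ w, w ∈ Γ ∧ wtN r a w = wtN r a u := ⟨v, hv, h⟩
  rw [wtG, dif_pos hex]
  exact hΓ.bij.injOn hex.choose_spec.1 hv (hex.choose_spec.2.trans h.symm)

lemma cmax_eq_one {v w : N3} (h : v ≤ w) (h2 : ¬ 2 • v ≤ w) : cmax v w = 1 := by
  have : {c : ℕ | c • v ≤ w} = Set.Iic 1 := by
    ext c
    simp only [Set.mem_ofPred_eq, Set.mem_Iic]
    refine ⟨fun hc => ?_, fun hc => ?_⟩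
    · by_contra hlt
      exact h2 ((nsmul_le_nsmul_left zero_le (by omega)).trans hc)
    · exact (nsmul_le_nsmul_left zero_le hc).trans (by simpa using h)
  rw [cmax, this, csSup_Iic]

lemma cmax_eq_zero {v w : N3} (h : ¬ v ≤ w) : cmax v w = 0 := by
  have : {c : ℕ | c • v ≤ w} = Set.Iic 0 := by
    ext c
    simp only [Set.mem_ofPred_eq, Set.mem_Iic]
    refine ⟨fun hc => ?_, fun hc => ?_⟩
    · by_contra hlt
      refine h (le_trans ?_ hc)
      simpa using nsmul_le_nsmul_left (zero_le (a := v)) (show 1 ≤ c by omega)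
    · obtain rfl : c = 0 := by omega
      simp
  rw [cmax, this, csSup_Iic]

/-- When no element of `Γ` is divisible by twice `v = wt_Γ(u)`, the transformation in direction
`u` replaces each multiple `w` of `v` in `Γ` by `w + u - v` and fixes the rest. -/
lemma mem_jig_iff {r a : ℕ} {Γ : Set N3} (hΓ : IsGSet r a Γ) {u v : N3} (hv : v ∈ Γ)
    (h : wtN r a v = wtN r a u) (h2 : ∀ w ∈ Γ, ¬ 2 • v ≤ w) (x : N3) :
    x ∈ jig r a Γ u ↔ (x ∈ Γ ∧ ¬ v ≤ x) ∨ ∃ w ∈ Γ, v ≤ w ∧ x + v = w + u := by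
  have key : ∀ w ∈ Γ, (toZ x = toZ w + (cmax v w) • (toZ u - toZ v) ↔
      (x = w ∧ ¬ v ≤ w) ∨ (v ≤ w ∧ x + v = w + u)) := by
    intro w hw
    by_cases hvw : v ≤ w
    · rw [cmax_eq_one hvw (h2 w hw)]
      obtain ⟨x₁, x₂, x₃⟩ := x
      simp only [hvw, toZ, one_smul, Prod.ext_iff, Prod.fst_add, Prod.snd_add, Prod.fst_sub,
        Prod.snd_sub, not_true_eq_false, and_false, false_or, true_and]
      omega
    · rw [cmax_eq_zero hvw]
      simp only [hvw, toZ, zero_smul, add_zero, Prod.ext_iff, not_false_eq_true, and_true,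
        false_and, or_false]
      omega
  simp only [jig, wtG_eq hΓ hv h, Set.mem_ofPred_eq]
  constructor
  · rintro ⟨w, hw, e⟩
    rcases (key w hw).1 e with ⟨rfl, h'⟩ | h'
    · exact Or.inl ⟨hw, h'⟩
    · exact Or.inr ⟨w, hw, h'⟩
  · rintro (⟨hx, h'⟩ | ⟨w, hw, h'⟩)
    · exact ⟨x, hx, (key x hx).2 (Or.inl ⟨rfl, h'⟩)⟩
    · exact ⟨w, hw, (key w hw).2 (Or.inr h')⟩

lemma mem_spanSet_four {i₁ j₁ i₂ k₂ i₃ j₃ i₄ k₄ m n p : ℕ} :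
    (m, n, p) ∈ spanSet {(i₁, j₁, 0), (i₂, 0, k₂), (i₃, j₃, 0), (i₄, 0, k₄)} ↔
      (m ≤ i₁ ∧ n ≤ j₁ ∧ p = 0) ∨ (m ≤ i₂ ∧ n = 0 ∧ p ≤ k₂) ∨
      (m ≤ i₃ ∧ n ≤ j₃ ∧ p = 0) ∨ (m ≤ i₄ ∧ n = 0 ∧ p ≤ k₄) := by
  simp [spanSet, Prod.mk_le_mk]

/-- `G`-igsaw transformations of a `G`-set with two valleys. -/
theorem stmt11 (r a : ℕ) (hra : Nat.Coprime r a) (ha2 : 2 ≤ a) (halt : a < r - a) (Γ : Set N3) (hΓ : IsGSet r a Γ)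
    (iy jy iz kz : ℕ)
    (hyv : IsYValley Γ iy jy) (hzv : IsZValley Γ iz kz)
    (hyu : ∀ m n : ℕ, IsYValley Γ m n → (m, n) = (iy, jy))
    (hzu : ∀ m n : ℕ, IsZValley Γ m n → (m, n) = (iz, kz))
    (i j k : ℕ)
    (hi : (i, 0, 0) ∈ Γ ∧ (i + 1, 0, 0) ∉ Γ)
    (hj : (0, j, 0) ∈ Γ ∧ (0, j + 1, 0) ∉ Γ)
    (hk : (0, 0, k) ∈ Γ ∧ (0, 0, k + 1) ∉ Γ)
    (hspan : Γ = spanSet {(i, jy, 0), (i, 0, kz), (iy, j, 0), (iz, 0, k)}) :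
    (1 ≤ kz → TR r a Γ = spanSet {(i, jy, 0), (i, 0, kz - 1), (iy, j + 1, 0), (iz, 0, k)}) ∧
    (1 ≤ jy → TL r a Γ = spanSet {(i, jy - 1, 0), (i, 0, kz), (iy, j, 0), (iz, 0, k + 1)}) ∧
    TUR r a Γ = spanSet {(i, jy + 1, 0), (i, 0, kz), (iy, j, 0), (iz, 0, k - 1)} ∧
    TUL r a Γ = spanSet {(i, jy, 0), (i, 0, kz + 1), (iy, j - 1, 0), (iz, 0, k)} := by
  have har : a ≤ r := by omega
  have hmem : ∀ m n p : ℕ, (m, n, p) ∈ Γ ↔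
      (m ≤ i ∧ n ≤ jy ∧ p = 0) ∨ (m ≤ i ∧ n = 0 ∧ p ≤ kz) ∨
      (m ≤ iy ∧ n ≤ j ∧ p = 0) ∨ (m ≤ iz ∧ n = 0 ∧ p ≤ k) := by
    intro m n p
    rw [hspan]
    exact mem_spanSet_four
  have hyV : (yValley Γ) = (iy, jy) := by
    have hex : ∃ p : ℕ × ℕ, IsYValley Γ p.1 p.2 := ⟨(iy, jy), hyv⟩
    rw [yValley, dif_pos hex]
    exact hyu _ _ hex.choose_spec
  have hzV : (zValley Γ) = (iz, kz) := by
    have hex : ∃ p : ℕ × ℕ, IsZValley Γ p.1 p.2 := ⟨(iz, kz), hzv⟩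
    rw [zValley, dif_pos hex]
    exact hzu _ _ hex.choose_spec
  obtain ⟨hiyi, hizi, hjyj, hkzk⟩ : iy < i ∧ iz < i ∧ jy < j ∧ kz < k := by
    obtain ⟨-, hy₁, hy₂, -⟩ := hyv
    obtain ⟨-, hz₁, hz₂, -⟩ := hzv
    replace hi := hi.2
    replace hj := hj.2
    replace hk := hk.2
    rw [hmem] at hy₁ hy₂ hz₁ hz₂ hi hj hk
    have hle : iy ≤ i ∧ iz ≤ i := by
      clear hy₁ hy₂ hz₁ hz₂ hj hk
      omega
    have hle' : jy ≤ j ∧ kz ≤ k := by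
      clear hy₁ hy₂ hz₁ hz₂ hi
      omega
    clear hi hj hk
    refine ⟨?_, ?_, ?_, ?_⟩
    · clear hy₂ hz₁ hz₂
      omega
    · clear hy₁ hy₂ hz₂
      omega
    · clear hy₁ hz₁ hz₂
      omega
    · clear hy₁ hy₂ hz₁
      omega
  clear hyv hzv hyu hzu hi hj hk
  have hjOf : jOf Γ = j := by
    have : {n : ℕ | (0, n, 0) ∈ Γ} = Set.Iic j := by
      ext n
      simp only [Set.mem_ofPred_eq, Set.mem_Iic, hmem, and_true]
      omega
    rw [jOf, this, csSup_Iic]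
  have hkOf : kOf Γ = k := by
    have : {n : ℕ | (0, 0, n) ∈ Γ} = Set.Iic k := by
      ext n
      simp only [Set.mem_ofPred_eq, Set.mem_Iic, hmem, true_and]
      omega
    rw [kOf, this, csSup_Iic]
  have hreg : ∀ m t : ℤ, Region i iy iz j jy k kz m t →
      (m.toNat, t.toNat, (-t).toNat) ∈ Γ := by
    intro m t h
    unfold Region at h
    rw [hmem]
    omega
  obtain ⟨h1, h2, h3⟩ := region_relations (weightLattice r a) (i := i) (iy := iy) (iz := iz)
    (j := j) (jy := jy) (k := k) (kz := kz) (by omega) (by omega) (by omega) (by omega) (by omega)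
    (by omega) (by omega) (by omega)
    (by
      intro m t m' t' h h' hL
      have := hΓ.bij.injOn (hreg m t h) (hreg m' t' h') ((wtN_eq_iff har _ _).2 (by
        unfold Region at h h'
        have e : (((m.toNat : ℤ) - m'.toNat, ((t.toNat : ℤ) - (-t).toNat) -
            ((t'.toNat : ℤ) - (-t').toNat)) : ℤ × ℤ) = (m - m', t - t') := by
          rw [Prod.mk.injEq]
          omega
        exact e ▸ hL))
      simp only [Prod.mk.injEq] at this
      unfold Region at h h'
      omega)
    (by
      intro m t
      obtain ⟨⟨m', n', p'⟩, hw, e⟩ := hΓ.bij.surjOn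
        (Set.mem_univ ((m : ZMod r) + a * (t : ZMod r)))
      refine ⟨m', (n' : ℤ) - p', ?_, ?_⟩
      · rw [hmem] at hw
        unfold Region
        omega
      · have hc : ((r - a : ℕ) : ZMod r) = -a := by
          rw [Nat.cast_sub har]; simp
        change (_ : ZMod r) + a * _ = 0
        simp only [wtN, wtZ, toZ, hc] at e
        push_cast at e ⊢
        linear_combination -e)
  have hw1 : ∀ {v u : N3}, (u.1 : ℤ) - v.1 = iy + 1 →
      ((u.2.1 : ℤ) - u.2.2) - ((v.2.1 : ℤ) - v.2.2) = jy + k + 1 →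
      wtN r a v = wtN r a u := by
    intro v u e e'
    refine ((wtN_eq_iff har u v).2 ?_).symm
    rwa [e, e']
  have hw2 : ∀ {v u : N3}, (u.1 : ℤ) - v.1 = iz + 1 →
      ((u.2.1 : ℤ) - u.2.2) - ((v.2.1 : ℤ) - v.2.2) = -(kz + j + 1) →
      wtN r a v = wtN r a u := by
    intro v u e e'
    refine ((wtN_eq_iff har u v).2 ?_).symm
    rwa [e, e']
  refine ⟨fun hkz => ?_, fun hjy => ?_, ?_, ?_⟩
  · ext ⟨m, n, p⟩
    rw [TR, hjOf, mem_jig_iff hΓ (v := (iz + 1, 0, kz)) ((hmem _ _ _).2 (by omega))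
      (hw2 (by push_cast; ring) (by push_cast; ring)).symm
      (by
        rintro ⟨m, n, p⟩ hw
        rw [hmem] at hw
        simp only [Prod.smul_mk, smul_eq_mul, Prod.mk_le_mk]
        omega)]
    simp only [mem_spanSet_four, hmem, Prod.exists, Prod.mk_le_mk, Prod.mk_add_mk, Prod.mk.injEq]
    constructor
    · rintro (h | ⟨m', n', p', h⟩) <;> omega
    · intro h
      by_cases hn : n = j + 1
      · exact Or.inr ⟨m + (iz + 1), 0, kz, by omega⟩
      · exact Or.inl (by omega)
  · ext ⟨m, n, p⟩
    rw [TL, hkOf, mem_jig_iff hΓ (v := (iy + 1, jy, 0)) ((hmem _ _ _).2 (by omega))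
      (hw1 (by push_cast; ring) (by push_cast; ring)).symm
      (by
        rintro ⟨m, n, p⟩ hw
        rw [hmem] at hw
        simp only [Prod.smul_mk, smul_eq_mul, Prod.mk_le_mk]
        omega)]
    simp only [mem_spanSet_four, hmem, Prod.exists, Prod.mk_le_mk, Prod.mk_add_mk, Prod.mk.injEq]
    constructor
    · rintro (h | ⟨m', n', p', h⟩) <;> omega
    · intro h
      by_cases hp : p = k + 1
      · exact Or.inr ⟨m + (iy + 1), jy, 0, by omega⟩
      · exact Or.inl (by omega)
  · ext ⟨m, n, p⟩
    rw [TUR, hyV, mem_jig_iff hΓ (v := (0, 0, k)) ((hmem _ _ _).2 (by omega))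
      (hw1 (by push_cast; ring) (by push_cast; ring))
      (by
        rintro ⟨m, n, p⟩ hw
        rw [hmem] at hw
        simp only [Prod.smul_mk, smul_eq_mul, Prod.mk_le_mk]
        omega)]
    simp only [mem_spanSet_four, hmem, Prod.exists, Prod.mk_le_mk, Prod.mk_add_mk, Prod.mk.injEq]
    constructor
    · rintro (h | ⟨m', n', p', h⟩) <;> omega
    · intro h
      by_cases hn : n = jy + 1 ∧ iy < m
      · exact Or.inr ⟨m - (iy + 1), 0, k, by omega⟩
      · exact Or.inl (by omega)
  · ext ⟨m, n, p⟩
    rw [TUL, hzV, mem_jig_iff hΓ (v := (0, j, 0)) ((hmem _ _ _).2 (by omega))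
      (hw2 (by push_cast; ring) (by push_cast; ring))
      (by
        rintro ⟨m, n, p⟩ hw
        rw [hmem] at hw
        simp only [Prod.smul_mk, smul_eq_mul, Prod.mk_le_mk]
        omega)]
    simp only [mem_spanSet_four, hmem, Prod.exists, Prod.mk_le_mk, Prod.mk_add_mk, Prod.mk.injEq]
    constructor
    · rintro (h | ⟨m', n', p', h⟩) <;> omega
    · intro h
      by_cases hp : p = kz + 1 ∧ iz < m
      · exact Or.inr ⟨m - (iz + 1), j, 0, by omega⟩
      · exact Or.inl (by omega)

end GH
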